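/- arXiv:2211.08917 — 3 statements merged into one kernel-verified Lean document; each statement's English description precedes it below -/
import Mathlib

section
/- For every nonzero real number z, the function w ↦ 1/(4·z·w·(z−w)²) − 1/((z² − w²)²) tends to 1/(16·z⁴) as w → z with w ≠ z. -/
/-- For nonzero real `z`, `w ↦ 1/(4zw(z−w)²) − 1/((z² − w²)²)` tends to `1/(16z⁴)`
as `w → z`, `w ≠ z`. -/
theorem stmt_7 (z : ℝ) (hz : z ≠ 0) :
    Filter.Tendsto
      (fun w : ℝ => 1 / (4 * z * w * (z - w) ^ 2) - 1 / ((z ^ 2 - w ^ 2) ^ 2))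
      (nhdsWithin z {z}ᶜ) (nhds (1 / (16 * z ^ 4))) := by
  have hc : ContinuousAt (fun w : ℝ => 1 / (4 * z * w * (z + w) ^ 2)) z := by
    have h0 : 4 * z * z * (z + z) ^ 2 ≠ 0 := by
      have : 4 * z * z * (z + z) ^ 2 = 16 * z ^ 4 := by ring
      rw [this]; positivity
    exact ContinuousAt.div (by fun_prop) (by fun_prop) h0
  have h1 : Filter.Tendsto (fun w : ℝ => 1 / (4 * z * w * (z + w) ^ 2))
      (nhdsWithin z {z}ᶜ) (nhds (1 / (16 * z ^ 4))) := by
    have h2 := hc.tendsto.mono_left (nhdsWithin_le_nhds (s := {z}ᶜ))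
    have h3 : 4 * z * z * (z + z) ^ 2 = 16 * z ^ 4 := by ring
    simpa only [h3] using h2
  refine h1.congr' ?_
  have hw0 : ∀ᶠ w in nhdsWithin z {z}ᶜ, w ≠ 0 :=
    (continuousAt_id.eventually_ne hz).filter_mono nhdsWithin_le_nhds
  have hzw : ∀ᶠ w in nhdsWithin z {z}ᶜ, z + w ≠ 0 := by
    have hcc : ContinuousAt (fun w : ℝ => z + w) z := by fun_prop
    refine (hcc.eventually_ne ?_).filter_mono nhdsWithin_le_nhds
    intro h
    exact hz (by linarith)
  filter_upwards [hw0, hzw, self_mem_nhdsWithin] with w h2 h3 h4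
  have h5 : z - w ≠ 0 := sub_ne_zero.mpr (Ne.symm h4)
  have h6 : z ^ 2 - w ^ 2 = (z - w) * (z + w) := by ring
  rw [h6]
  field_simp
  ring
end

section
/- For every real y > 0, the following identity of iterated derivatives holds (D^k denotes the k-th iterated derivative, and real powers are real powers of positive reals): (1/2)·D(s ↦ 2s·(13/(128·s^{10})))(y) − (1/2)·D²(s ↦ 2s·(1/(16·s⁴))·(−1/(32·s⁵)))(y) − (1/48)·D⁴(s ↦ 2s·(1/(16·s⁴))·D²(t ↦ t^{1/2})(s²))(y) + (1/24)·D³(s ↦ 2s·D²(t ↦ 1/(4·t^{1/2}·s·(t^{1/2}+s)²))(s²))(y) = −477/(128·y^{10}). -/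
lemma aux_step (f : ℝ → ℝ) (c : ℝ) (m : ℤ) (h : ∀ s : ℝ, 0 < s → f s = c * s ^ m) :
    ∀ s : ℝ, 0 < s → deriv f s = (c * m) * s ^ (m - 1) := by
  intro s hs
  have he : f =ᶠ[nhds s] fun s => c * s ^ m := by
    filter_upwards [lt_mem_nhds hs] with u hu using h u hu
  rw [he.deriv_eq, ((hasDerivAt_zpow m s (Or.inl hs.ne')).const_mul c).deriv]
  ring

lemma aux_iter2 (f g h : ℝ → ℝ) (hf : ∀ t : ℝ, 0 < t → HasDerivAt f (g t) t)
    (t : ℝ) (ht : 0 < t) (hg : HasDerivAt g (h t) t) : iteratedDeriv 2 f t = h t := by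
  rw [iteratedDeriv_succ, iteratedDeriv_one]
  have he : deriv f =ᶠ[nhds t] g := by
    filter_upwards [lt_mem_nhds ht] with u hu using (hf u hu).deriv
  rw [he.deriv_eq, hg.deriv]

lemma aux_sqrt (s : ℝ) (hs : 0 < s) :
    iteratedDeriv 2 (fun t : ℝ => t ^ ((1 : ℝ) / 2)) (s ^ 2) = -1 / 4 * s ^ (-3 : ℤ) := by
  have e : (fun t : ℝ => t ^ ((1 : ℝ) / 2)) = fun t => √t := by
    funext t; rw [Real.sqrt_eq_rpow]
  rw [e]
  have hd : ∀ t : ℝ, 0 < t → HasDerivAt (fun t => √t) (1 / (2 * √t)) t :=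
    fun t ht => Real.hasDerivAt_sqrt ht.ne'
  rw [aux_iter2 _ (fun t => 1 / (2 * √t))
    (fun t => (0 * (2 * √t) - 1 * (2 * (1 / (2 * √t)))) / (2 * √t) ^ 2) hd (s ^ 2) (by positivity)]
  · simp only [Real.sqrt_sq hs.le]
    rw [show (-3 : ℤ) = -((3 : ℕ) : ℤ) by norm_num, zpow_neg, zpow_natCast]
    field_simp
    norm_num
  · have hp : 0 < s ^ 2 := by positivity
    have := Real.sqrt_pos.2 hp
    exact (hasDerivAt_const (s ^ 2) (1 : ℝ)).div ((hd _ hp).const_mul 2) (by positivity)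

lemma aux_W (s : ℝ) (hs : 0 < s) :
    iteratedDeriv 2
      (fun t : ℝ => 1 / (4 * t ^ ((1 : ℝ) / 2) * s * (t ^ ((1 : ℝ) / 2) + s) ^ 2)) (s ^ 2)
      = 15 / 128 * s ^ (-8 : ℤ) := by
  simp only [← Real.sqrt_eq_rpow]
  have hd : ∀ t : ℝ, 0 < t → HasDerivAt (fun t => √t) (1 / (2 * √t)) t :=
    fun t ht => Real.hasDerivAt_sqrt ht.ne'
  -- first derivative in `u = √t`
  have h1 : ∀ u : ℝ, 0 < u → HasDerivAt (fun u : ℝ => 1 / (4 * u * s * (u + s) ^ 2))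
      (-(3 * u + s) / (4 * s * u ^ 2 * (u + s) ^ 3)) u := by
    intro u hu
    have hi := hasDerivAt_id' u
    have := (hasDerivAt_const u (1 : ℝ)).div
      (((hi.const_mul 4).mul_const s).mul ((hi.add_const s).pow 2)) (by simp only [Pi.mul_apply, Pi.pow_apply]; positivity)
    refine this.congr_deriv ?_
    simp only [Pi.mul_apply, Pi.pow_apply]
    field_simp
    ring
  have h2 : HasDerivAt (fun u : ℝ => -(3 * u + s) / (4 * s * u ^ 2 * (u + s) ^ 3) * (1 / (2 * u)))
      (15 / 64 * s ^ (-7 : ℤ)) s := by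
    have hi := hasDerivAt_id' s
    have := ((((hi.const_mul 3).add_const s).neg).div
      (((hi.pow 2).const_mul (4 * s)).mul ((hi.add_const s).pow 3))
      (by simp only [Pi.mul_apply, Pi.pow_apply]; positivity)).mul
      ((hasDerivAt_const s (1 : ℝ)).div (hi.const_mul 2) (by positivity))
    refine this.congr_deriv ?_
    rw [show (-7 : ℤ) = -((7 : ℕ) : ℤ) by norm_num, zpow_neg, zpow_natCast]
    simp
    field_simp
    ring
  have hp : 0 < s ^ 2 := by positivity
  have hss : √(s ^ 2) = s := Real.sqrt_sq hs.le
  rw [aux_iter2 (fun t => 1 / (4 * √t * s * (√t + s) ^ 2))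
    (fun t => -(3 * √t + s) / (4 * s * √t ^ 2 * (√t + s) ^ 3) * (1 / (2 * √t)))
    (fun _ => 15 / 64 * s ^ (-7 : ℤ) * (1 / (2 * √(s ^ 2))))
    (fun t ht => (h1 _ (Real.sqrt_pos.2 ht)).comp t (hd t ht)) (s ^ 2) hp]
  · rw [hss, show (-8 : ℤ) = -7 - 1 by norm_num, zpow_sub_one₀ hs.ne']
    field_simp
    norm_num
  · have h2a : HasDerivAt
        (fun u : ℝ => -(3 * u + s) / (4 * s * u ^ 2 * (u + s) ^ 3) * (1 / (2 * u)))
        (15 / 64 * s ^ (-7 : ℤ)) (√(s ^ 2)) := by rw [hss]; exact h2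
    exact HasDerivAt.comp (s ^ 2) h2a (hd _ hp)

/-- Airy-curve evaluation of the second group of terms (eq. (30)) in the x-y duality
formula for `W^∨_{2,1}`: for real `y > 0` the displayed combination of iterated
derivatives equals `−477/(128·y¹⁰)`. -/
theorem stmt_10 (y : ℝ) (hy : 0 < y) :
    (1 / 2) * deriv (fun s : ℝ => 2 * s * (13 / (128 * s ^ 10))) y -
      (1 / 2) * iteratedDeriv 2
        (fun s : ℝ => 2 * s * (1 / (16 * s ^ 4)) * (-1 / (32 * s ^ 5))) y -
      (1 / 48) * iteratedDeriv 4
        (fun s : ℝ => 2 * s * (1 / (16 * s ^ 4)) *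
          iteratedDeriv 2 (fun t : ℝ => t ^ ((1 : ℝ) / 2)) (s ^ 2)) y +
      (1 / 24) * iteratedDeriv 3
        (fun s : ℝ => 2 * s *
          iteratedDeriv 2
            (fun t : ℝ => 1 / (4 * t ^ ((1 : ℝ) / 2) * s * (t ^ ((1 : ℝ) / 2) + s) ^ 2))
            (s ^ 2)) y =
    -477 / (128 * y ^ 10) := by
  have a1 := aux_step (fun s : ℝ => 2 * s * (13 / (128 * s ^ 10))) (13 / 64) (-9) (by
    intro s hs
    rw [show (-9 : ℤ) = -((9 : ℕ) : ℤ) by norm_num, zpow_neg, zpow_natCast]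
    field_simp
    norm_num) y hy
  have a2 := aux_step _ _ _ (aux_step
    (fun s : ℝ => 2 * s * (1 / (16 * s ^ 4)) * (-1 / (32 * s ^ 5))) (-1 / 256) (-8) (by
    intro s hs
    rw [show (-8 : ℤ) = -((8 : ℕ) : ℤ) by norm_num, zpow_neg, zpow_natCast]
    field_simp
    norm_num)) y hy
  have a3 := aux_step _ _ _ (aux_step _ _ _ (aux_step _ _ _ (aux_step
    (fun s : ℝ => 2 * s * (1 / (16 * s ^ 4)) *
          iteratedDeriv 2 (fun t : ℝ => t ^ ((1 : ℝ) / 2)) (s ^ 2)) (-1 / 32) (-6) (by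
    intro s hs
    simp only [aux_sqrt s hs]
    rw [show (-3 : ℤ) = -((3 : ℕ) : ℤ) by norm_num, zpow_neg, zpow_natCast,
      show (-6 : ℤ) = -((6 : ℕ) : ℤ) by norm_num, zpow_neg, zpow_natCast]
    field_simp
    norm_num)))) y hy
  have a4 := aux_step _ _ _ (aux_step _ _ _ (aux_step
    (fun s : ℝ => 2 * s *
          iteratedDeriv 2
            (fun t : ℝ => 1 / (4 * t ^ ((1 : ℝ) / 2) * s * (t ^ ((1 : ℝ) / 2) + s) ^ 2))
            (s ^ 2)) (15 / 64) (-7) (by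
    intro s hs
    simp only [aux_W s hs]
    rw [show (-8 : ℤ) = -((8 : ℕ) : ℤ) by norm_num, zpow_neg, zpow_natCast,
      show (-7 : ℤ) = -((7 : ℕ) : ℤ) by norm_num, zpow_neg, zpow_natCast]
    field_simp
    norm_num))) y hy
  have e2 : ∀ f : ℝ → ℝ, iteratedDeriv 2 f = deriv (deriv f) := fun f => by
    rw [iteratedDeriv_succ, iteratedDeriv_one]
  have e3 : ∀ f : ℝ → ℝ, iteratedDeriv 3 f = deriv (deriv (deriv f)) := fun f => by
    rw [iteratedDeriv_succ, e2]
  have e4 : ∀ f : ℝ → ℝ, iteratedDeriv 4 f = deriv (deriv (deriv (deriv f))) := fun f => by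
    rw [iteratedDeriv_succ, e3]
  rw [a1, e2 (fun s : ℝ => 2 * s * (1 / (16 * s ^ 4)) * (-1 / (32 * s ^ 5))), a2, e4, a3, e3, a4]
  have hz : y ^ (-10 : ℤ) = (y ^ 10)⁻¹ := by
    rw [show (-10 : ℤ) = -((10 : ℕ) : ℤ) by norm_num, zpow_neg, zpow_natCast]
  norm_num [hz]
  field_simp
  norm_num
end

section
/- Let x, Φ, f : ℝ → ℝ be real-analytic on all of ℝ, suppose Φ′(x(y)) = y for every y ∈ ℝ, and let y₀ ∈ ℝ with x(y₀) ≠ 0. For u ≠ 0 set S(u) := (e^{u/2} − e^{−u/2})/u, and define A(u,y) := (Φ(e^{u/2}·x(S(u)·y)) − Φ(e^{−u/2}·x(S(u)·y)))/(u·S(u)·x(S(u)·y)) − y and B(u,y) := (Φ(e^{u/2}·x(y)/cosh(u/2)) − Φ(e^{−u/2}·x(y)/cosh(u/2)))/(u·S(u)·x(y)/cosh(u/2)) − y. Then for every natural number N, the function of u ≠ 0 given by cosh(u/2)·S(u)·∑_{j=0}^{N} (−1)^j·∂_y^j[ x′(S(u)·y)·f(x(S(u)·y))·A(u,y)^j/j!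 ]|_{y=y₀} − ∑_{j=0}^{N} (−1)^j·∂_y^j[ x′(y)·f(x(y)/cosh(u/2))·B(u,y)^j/j! ]|_{y=y₀} is little-o of u^{2N+1} as u → 0 through nonzero values. (Here ∂_y^j denotes the j-th iterated partial derivative in y at fixed u, and x′ = deriv x.) -/
open Asymptotics

/-- `S(u) = (e^{u/2} − e^{−u/2})/u`. -/
noncomputable def S14 (u : ℝ) : ℝ := (Real.exp (u / 2) - Real.exp (-u / 2)) / u

/-- The bracket `A(u,y)` of Lemma 2.4. -/
noncomputable def A14 (x Φ : ℝ → ℝ) (u y : ℝ) : ℝ :=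
  (Φ (Real.exp (u / 2) * x (S14 u * y)) - Φ (Real.exp (-u / 2) * x (S14 u * y))) /
    (u * S14 u * x (S14 u * y)) - y

/-- The bracket `B(u,y)` of Lemma 2.4. -/
noncomputable def B14 (x Φ : ℝ → ℝ) (u y : ℝ) : ℝ :=
  (Φ (Real.exp (u / 2) * x y / Real.cosh (u / 2)) -
      Φ (Real.exp (-u / 2) * x y / Real.cosh (u / 2))) /
    (u * S14 u * x y / Real.cosh (u / 2)) - y

open Filter Topology Complex in
lemma ext14 (f : ℝ → ℝ) (a : ℝ) (hf : AnalyticAt ℝ f a) :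
    ∃ F : ℂ → ℂ, AnalyticAt ℂ F a ∧ ∀ᶠ t : ℝ in 𝓝 a, F t = f t := by
  obtain ⟨p, hp⟩ := hf
  let P : FormalMultilinearSeries ℂ ℂ ℂ :=
    FormalMultilinearSeries.ofScalars ℂ (fun n => ((p.coeff n : ℝ) : ℂ))
  have hn : ∀ n, ‖P n‖ = ‖p n‖ := by
    intro n
    simp only [P]
    rw [FormalMultilinearSeries.ofScalars_norm, FormalMultilinearSeries.norm_apply_eq_norm_coef]
    simp
  have hr : 0 < P.radius := by
    have : P.radius = p.radius := by
      simp [FormalMultilinearSeries.radius, hn]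
    rw [this]
    exact hp.radius_pos
  have hP := (P.hasFPowerSeriesOnBall hr)
  refine ⟨fun z => P.sum (z - a), ?_, ?_⟩
  · have h1 : AnalyticAt ℂ P.sum 0 := hP.analyticAt
    have h2 : AnalyticAt ℂ P.sum ((a : ℂ) - a) := by simpa using h1
    exact AnalyticAt.fun_comp (g := P.sum) (f := fun z : ℂ => z - a) h2 (by fun_prop)
  · have h1 := hasFPowerSeriesAt_iff.1 hp
    have h2 : Tendsto (fun t : ℝ => t - a) (𝓝 a) (𝓝 0) := by
      have : Continuous (fun t : ℝ => t - a) := by fun_prop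
      simpa using this.tendsto a
    filter_upwards [h2.eventually h1] with t ht
    have h3 := Complex.hasSum_ofReal.2 ht
    simp only [add_sub_cancel] at h3
    rw [← h3.tsum_eq]
    simp only [FormalMultilinearSeries.sum, P]
    congr 1
    ext n
    rw [FormalMultilinearSeries.ofScalars_apply_eq]
    simp [mul_comm]

open Filter Topology Complex in
lemma derivT14 (F : ℂ → ℂ) (g : ℝ → ℝ) (a : ℝ) (hF : AnalyticAt ℂ F a)
    (h : ∀ᶠ t : ℝ in 𝓝 a, F t = g t) :
    ∀ᶠ t : ℝ in 𝓝 a, deriv F t = (deriv g t : ℝ) := by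
  have hc : Tendsto (fun t : ℝ => (t : ℂ)) (𝓝 a) (𝓝 (a : ℂ)) := Complex.continuous_ofReal.tendsto a
  filter_upwards [h.eventually_nhds, hc.eventually hF.eventually_analyticAt] with t ht hF
  have h1 := hF.differentiableAt.hasDerivAt
  have h2 := h1.comp_ofReal
  have h3 := h1.real_of_complex
  have h4 : HasDerivAt g (deriv F t).re t := h3.congr_of_eventuallyEq (by
    filter_upwards [ht] with s hs; simp [hs])
  have h5 : HasDerivAt (fun y : ℝ => F y) (((deriv F t).re : ℝ) : ℂ) t :=
    h4.ofReal_comp.congr_of_eventuallyEq ht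
  rw [h4.deriv]
  exact h2.unique h5

open Filter Topology Complex in
lemma iterT14 (F : ℂ → ℂ) (g : ℝ → ℝ) (a : ℝ) (hF : AnalyticAt ℂ F a)
    (h : ∀ᶠ t : ℝ in 𝓝 a, F t = g t) (k : ℕ) :
    iteratedDeriv k F a = (iteratedDeriv k g a : ℝ) := by
  induction k generalizing F g with
  | zero => simpa using h.self_of_nhds
  | succ k ih =>
    rw [iteratedDeriv_succ', iteratedDeriv_succ']
    exact ih _ _ hF.deriv (derivT14 F g a hF h)
open Filter Topology Metric in
lemma P014 (Φ : ℂ → ℂ) (U : Set ℂ) (hU : IsOpen U) (x0 : ℂ) (r M : ℝ) (hr : 0 < r)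
    (hsub : closedBall x0 r ⊆ U) (hd : DifferentiableOn ℂ Φ U)
    (hM : ∀ z ∈ sphere x0 r, ‖Φ z‖ ≤ M) (X a b : ℂ) (hX : X ∈ ball x0 (r/2))
    (ha : a ∈ ball x0 (r/2)) (hb : b ∈ ball x0 (r/2)) (hab : a * b = X ^ 2) :
    ‖Φ a - Φ b - (a - b) * deriv Φ X‖ ≤
      r * (M * (‖a - b‖ * ‖a + b - 2 * X‖ * (‖x0‖ + r) * (2 / r) ^ 4)) := by
  have hlt : ball x0 (r/2) ⊆ ball x0 r := ball_subset_ball (by linarith)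
  have hdc : DiffContOnCl ℂ Φ (ball x0 r) := hd.diffContOnCl_ball hsub
  have e1 := hdc.two_pi_i_inv_smul_circleIntegral_sub_inv_smul (hlt ha)
  have e2 := hdc.two_pi_i_inv_smul_circleIntegral_sub_inv_smul (hlt hb)
  have e3 := Complex.two_pi_I_inv_smul_circleIntegral_sub_sq_inv_smul_of_differentiable hU hsub hd
    (hlt hX)
  have hcont : ContinuousOn Φ (sphere x0 r) :=
    (hd.continuousOn).mono (sphere_subset_closedBall.trans hsub)
  have lb : ∀ w ∈ ball x0 (r/2), ∀ z ∈ sphere x0 r, r / 2 ≤ ‖z - w‖ := by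
    intro w hw z hz
    rw [mem_ball, dist_eq_norm] at hw
    rw [mem_sphere, dist_eq_norm] at hz
    have : ‖z - x0‖ ≤ ‖z - w‖ + ‖w - x0‖ := norm_sub_le_norm_sub_add_norm_sub z w x0
    linarith
  have nz : ∀ w ∈ ball x0 (r/2), ∀ z ∈ sphere x0 r, z - w ≠ 0 := by
    intro w hw z hz h
    have := lb w hw z hz
    rw [h, norm_zero] at this
    linarith
  have ci : ∀ w ∈ ball x0 (r/2), CircleIntegrable (fun z => (z - w)⁻¹ • Φ z) x0 r := by
    intro w hw
    apply ContinuousOn.circleIntegrable hr.le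
    exact ((continuousOn_id.sub continuousOn_const).inv₀ (nz w hw)).smul hcont
  have ci2 : CircleIntegrable (fun z => (a - b) • (((z - X)^2)⁻¹ • Φ z)) x0 r := by
    apply ContinuousOn.circleIntegrable hr.le
    have hc2 : ContinuousOn (fun z : ℂ => (z - X) ^ 2) (sphere x0 r) := by fun_prop
    have hc3 := hc2.inv₀ (fun z hz => pow_ne_zero 2 (nz X hX z hz))
    exact (hc3.smul hcont).const_smul (a - b)
  have key : Φ a - Φ b - (a - b) * deriv Φ X = (2 * ↑Real.pi * Complex.I)⁻¹ •
      ∮ z in C(x0, r), ((z - a)⁻¹ • Φ z - (z - b)⁻¹ • Φ z - (a - b) • (((z - X)^2)⁻¹ • Φ z)) := by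
    have ci3 : CircleIntegrable (fun z => (z - a)⁻¹ • Φ z - (z - b)⁻¹ • Φ z) x0 r :=
      (ci a ha).sub (ci b hb)
    rw [circleIntegral.integral_sub ci3 ci2,
      circleIntegral.integral_sub (ci a ha) (ci b hb), circleIntegral.integral_smul,
      smul_sub, smul_sub, e1, e2, smul_comm, e3, smul_eq_mul]
  rw [key]
  apply circleIntegral.norm_two_pi_i_inv_smul_integral_le_of_norm_le_const hr.le
  intro z hz
  have na := nz a ha z hz
  have nb := nz b hb z hz
  have nX := nz X hX z hz
  have : (z - a)⁻¹ • Φ z - (z - b)⁻¹ • Φ z - (a - b) • (((z - X)^2)⁻¹ • Φ z) =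
      Φ z * ((a - b) * (a + b - 2 * X) * z * ((z - a)⁻¹ * (z - b)⁻¹ * ((z - X)⁻¹) * (z - X)⁻¹)) := by
    simp only [smul_eq_mul]
    field_simp
    linear_combination (-(a-b) * Φ z) * hab
  rw [this, norm_mul, norm_mul, norm_mul, norm_mul, norm_mul, norm_mul, norm_mul]
  have hz' : ‖z‖ ≤ ‖x0‖ + r := by
    rw [mem_sphere, dist_eq_norm] at hz
    have := norm_le_norm_add_norm_sub x0 z
    rw [norm_sub_rev] at this
    linarith
  have inv : ∀ w ∈ ball x0 (r/2), ‖(z - w)⁻¹‖ ≤ 2 / r := by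
    intro w hw
    rw [norm_inv, ← inv_div r 2]
    exact inv_anti₀ (by positivity) (lb w hw z hz)
  have h4 : ‖(z - a)⁻¹‖ * ‖(z - b)⁻¹‖ * ‖(z - X)⁻¹‖ * ‖(z - X)⁻¹‖ ≤ (2 / r) ^ 4 := by
    have := inv a ha
    have := inv b hb
    have := inv X hX
    calc _ ≤ (2/r) * (2/r) * (2/r) * (2/r) := by gcongr
      _ = _ := by ring
  have := (norm_nonneg _).trans (hM z hz)
  gcongr
  exact hM z hz

open Filter Topology Metric in
lemma Lag014 (G H : ℂ → ℂ) (c : ℂ) (ρ M ε : ℝ) (hρ : 0 < ρ)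
    (hG : DifferentiableOn ℂ G (closedBall c ρ)) (hH : DifferentiableOn ℂ H (closedBall c ρ))
    (hM : ∀ z ∈ sphere c ρ, ‖G z‖ ≤ M) (hε : ∀ z ∈ sphere c ρ, ‖H z‖ ≤ ε) (hερ : ε ≤ ρ / 2)
    (N : ℕ) :
    ‖∑ j ∈ Finset.range (N + 1), (-1 : ℂ) ^ j *
        iteratedDeriv j (fun y => G y * H y ^ j / (Nat.factorial j)) c -
      (2 * ↑Real.pi * Complex.I)⁻¹ • ∮ z in C(c, ρ), G z / (z - c + H z)‖ ≤
      ρ * (M * (ε / ρ) ^ (N + 1) * (2 / ρ)) := by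
  have hGc : ContinuousOn G (sphere c ρ) := hG.continuousOn.mono sphere_subset_closedBall
  have hHc : ContinuousOn H (sphere c ρ) := hH.continuousOn.mono sphere_subset_closedBall
  have nz : ∀ z ∈ sphere c ρ, z - c ≠ 0 := by
    intro z hz h
    rw [mem_sphere, dist_eq_norm, h, norm_zero] at hz
    linarith
  have lb : ∀ z ∈ sphere c ρ, ρ / 2 ≤ ‖z - c + H z‖ := by
    intro z hz
    have h1 := hε z hz
    rw [mem_sphere, dist_eq_norm] at hz
    have := norm_sub_le_norm_add (z - c) (H z)
    linarith
  have nz2 : ∀ z ∈ sphere c ρ, z - c + H z ≠ 0 := by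
    intro z hz h
    have := lb z hz
    rw [h, norm_zero] at this
    linarith
  have hpi : (2 * ↑Real.pi * Complex.I : ℂ) ≠ 0 := Complex.two_pi_I_ne_zero
  have e : ∀ j : ℕ, (-1 : ℂ) ^ j * iteratedDeriv j (fun y => G y * H y ^ j / (Nat.factorial j)) c =
      (2 * ↑Real.pi * Complex.I)⁻¹ • ∮ z in C(c, ρ), (-1) ^ j * (G z * H z ^ j / (z - c) ^ (j + 1)) := by
    intro j
    have hd : DiffContOnCl ℂ (fun y => G y * H y ^ j / (Nat.factorial j)) (ball c ρ) := by
      apply DifferentiableOn.diffContOnCl_ball (U := closedBall c ρ) _ subset_rfl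
      exact (hG.mul (hH.pow j)).div_const _
    have h1 := hd.circleIntegral_one_div_sub_center_pow_smul hρ j
    have hj : (Nat.factorial j : ℂ) ≠ 0 := by exact_mod_cast Nat.factorial_ne_zero j
    have h2 : ∮ z in C(c, ρ), (-1) ^ j * (G z * H z ^ j / (z - c) ^ (j + 1)) =
        ((-1) ^ j * (Nat.factorial j : ℂ)) * ∮ z in C(c, ρ), (1 / (z - c) ^ (j + 1)) • (G z * H z ^ j / (Nat.factorial j)) := by
      rw [← circleIntegral.integral_const_mul]
      congr 1
      ext z
      simp only [smul_eq_mul]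
      field_simp
    rw [h2, h1]
    simp only [smul_eq_mul]
    field_simp
  have ci : ∀ j : ℕ, CircleIntegrable (fun z => (-1) ^ j * (G z * H z ^ j / (z - c) ^ (j + 1))) c ρ := by
    intro j
    apply ContinuousOn.circleIntegrable hρ.le
    refine continuousOn_const.mul ((hGc.mul (hHc.pow j)).div ?_ ?_)
    · exact (continuousOn_id.sub continuousOn_const).pow _
    · intro z hz; exact pow_ne_zero _ (nz z hz)
  have ci2 : CircleIntegrable (fun z => G z / (z - c + H z)) c ρ := by
    apply ContinuousOn.circleIntegrable hρ.le
    exact hGc.div ((continuousOn_id.sub continuousOn_const).add hHc) nz2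
  rw [Finset.sum_congr rfl (fun j _ => e j), ← Finset.smul_sum,
    ← circleIntegral.integral_fun_sum (fun j _ => ci j), ← smul_sub,
    ← circleIntegral.integral_sub (CircleIntegrable.fun_sum _ (fun j _ => ci j)) ci2]
  apply circleIntegral.norm_two_pi_i_inv_smul_integral_le_of_norm_le_const hρ.le
  intro z hz
  have n1 := nz z hz
  have n2 := nz2 z hz
  have : ∑ j ∈ Finset.range (N + 1), (-1) ^ j * (G z * H z ^ j / (z - c) ^ (j + 1)) - G z / (z - c + H z)
      = - (G z * (-(H z) / (z - c)) ^ (N + 1) * (z - c + H z)⁻¹) := by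
    have hg := geom_sum_mul_neg (-(H z) / (z - c)) (N + 1)
    have h3 : ∑ j ∈ Finset.range (N + 1), (-1) ^ j * (G z * H z ^ j / (z - c) ^ (j + 1)) =
        (G z / (z - c)) * ∑ j ∈ Finset.range (N + 1), (-(H z) / (z - c)) ^ j := by
      rw [Finset.mul_sum]
      refine Finset.sum_congr rfl fun j _ => ?_
      rw [div_pow, neg_pow (H z)]
      field_simp
      ring
    rw [h3]
    have h4 : (1 - -(H z) / (z - c)) = (z - c + H z) / (z - c) := by field_simp; ring
    rw [h4, ← eq_sub_iff_add_eq.2 (sub_add_cancel _ _)] at hg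
    have h5 : ∑ j ∈ Finset.range (N + 1), (-(H z) / (z - c)) ^ j =
        (1 - (-(H z) / (z - c)) ^ (N + 1)) * (z - c) / (z - c + H z) := by
      rw [← hg]; field_simp
    rw [h5]
    field_simp
    ring
  rw [this, norm_neg, norm_mul, norm_mul, norm_pow, norm_div, norm_neg]
  have hzn : ‖z - c‖ = ρ := by rwa [mem_sphere, dist_eq_norm] at hz
  rw [hzn]
  have hinv : ‖(z - c + H z)⁻¹‖ ≤ 2 / ρ := by
    rw [norm_inv, ← inv_div ρ 2]
    exact inv_anti₀ (by positivity) (lb z hz)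
  have h1 := hM z hz
  have h2 := hε z hz
  have h3 : 0 ≤ M := (norm_nonneg _).trans h1
  have h4 : 0 ≤ ε := (norm_nonneg _).trans h2
  gcongr

open Filter Topology Metric in
lemma Res014 (G h : ℂ → ℂ) (c z : ℂ) (ρ : ℝ)
    (hG : DifferentiableOn ℂ G (closedBall c ρ)) (hh : DifferentiableOn ℂ h (closedBall c ρ))
    (hz : z ∈ ball c ρ) (hz0 : h z = 0) (hz1 : deriv h z ≠ 0)
    (huniq : ∀ y ∈ closedBall c ρ, h y = 0 → y = z) :
    (2 * ↑Real.pi * Complex.I)⁻¹ • (∮ y in C(c, ρ), G y / h y) = G z / deriv h z := by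
  have hnb : closedBall c ρ ∈ 𝓝 z := mem_of_superset (isOpen_ball.mem_nhds hz) ball_subset_closedBall
  have hk : DifferentiableOn ℂ (dslope h z) (closedBall c ρ) :=
    (Complex.differentiableOn_dslope hnb).2 hh
  have hk0 : ∀ y ∈ closedBall c ρ, dslope h z y ≠ 0 := by
    intro y hy
    by_cases hyz : y = z
    · rw [hyz, dslope_same]; exact hz1
    · intro h0
      have := sub_smul_dslope h z y
      rw [h0, smul_zero, hz0, sub_zero] at this
      exact hyz (huniq y hy this.symm)
  have hd : DiffContOnCl ℂ (fun y => G y / dslope h z y) (ball c ρ) :=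
    DifferentiableOn.diffContOnCl_ball (U := closedBall c ρ) (hG.div hk hk0) subset_rfl
  have h1 := hd.two_pi_i_inv_smul_circleIntegral_sub_inv_smul hz
  simp only [dslope_same] at h1
  rw [← h1]
  congr 2
  ext y
  have := sub_smul_dslope h z y
  rw [hz0, sub_zero] at this
  rw [← this]
  simp only [smul_eq_mul, div_eq_mul_inv, mul_inv]
  ring

open Filter Topology Metric in
lemma extr14 {l : Filter ℝ} {y0 : ℂ} {P : ℝ × ℂ → Prop} (h : ∀ᶠ p in l ×ˢ 𝓝 y0, P p) :
    ∃ r > 0, ∀ᶠ u in l, ∀ y ∈ closedBall y0 r, P (u, y) := by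
  obtain ⟨pa, ha, pb, hb, hab⟩ := eventually_prod_iff.1 h
  obtain ⟨r, hr, hrb⟩ := nhds_basis_closedBall.eventually_iff.1 hb
  exact ⟨r, hr, ha.mono fun u hu y hy => hab hu (hrb hy)⟩

open Filter Topology Metric in
lemma core14 (H : ℝ → ℂ → ℂ) (y0 : ℂ)
    (hH : ∀ᶠ p : ℝ × ℂ in 𝓝[≠] (0:ℝ) ×ˢ 𝓝 y0, DifferentiableAt ℂ (H p.1) p.2)
    (hHb : (fun p : ℝ × ℂ => H p.1 p.2) =O[𝓝[≠] (0:ℝ) ×ˢ 𝓝 y0] fun p => p.1 ^ 2) :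
    ∃ C > 0, ∃ ρ₀ > 0, ∀ ρ, 0 < ρ → ρ ≤ ρ₀ → ∀ᶠ u in 𝓝[≠] (0:ℝ),
      (∀ y ∈ closedBall y0 ρ, DifferentiableAt ℂ (H u) y ∧ ‖H u y‖ ≤ C * u ^ 2 ∧
        ‖deriv (H u) y‖ ≤ 1 / 2) ∧
      (∀ y ∈ closedBall y0 ρ, ∀ y' ∈ closedBall y0 ρ, ‖H u y - H u y'‖ ≤ 1 / 2 * ‖y - y'‖) ∧
      C * u ^ 2 ≤ ρ / 2 := by
  obtain ⟨C, hC, hb⟩ := hHb.exists_pos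
  obtain ⟨r, hr, h⟩ := extr14 (hH.and hb.bound)
  refine ⟨C, hC, r / 2, by positivity, fun ρ hρ hρr => ?_⟩
  have hlim : Tendsto (fun u : ℝ => C * u ^ 2) (𝓝[≠] (0:ℝ)) (𝓝 0) := by
    have : Continuous (fun u : ℝ => C * u ^ 2) := by fun_prop
    have := this.tendsto 0
    simp only [ne_eq, OfNat.ofNat_ne_zero, not_false_eq_true, zero_pow, mul_zero] at this
    exact this.mono_left nhdsWithin_le_nhds
  filter_upwards [h, hlim.eventually (eventually_le_nhds (show (0:ℝ) < ρ / 2 by positivity))] with u hu hu2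
  have hb1 : ∀ y ∈ closedBall y0 r, ‖H u y‖ ≤ C * u ^ 2 := by
    intro y hy
    have := (hu y hy).2
    simpa using this
  have hsub : closedBall y0 ρ ⊆ closedBall y0 r := closedBall_subset_closedBall (by linarith)
  have hder : ∀ y ∈ closedBall y0 ρ, ‖deriv (H u) y‖ ≤ 1 / 2 := by
    intro y hy
    have hs : closedBall y ρ ⊆ closedBall y0 r := by
      intro w hw
      rw [mem_closedBall] at *
      have := dist_triangle w y y0
      linarith
    have hd : DiffContOnCl ℂ (H u) (ball y ρ) :=
      DifferentiableOn.diffContOnCl_ball (U := closedBall y ρ)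
        (fun w hw => (hu w (hs hw)).1.differentiableWithinAt) subset_rfl
    have h1 := Complex.norm_deriv_le_of_forall_mem_sphere_norm_le hρ hd
      (fun w hw => hb1 w (hs (sphere_subset_closedBall hw)))
    refine h1.trans ?_
    rw [div_le_iff₀ hρ]
    linarith
  refine ⟨fun y hy => ⟨(hu y (hsub hy)).1, hb1 y (hsub hy), hder y hy⟩, ?_, hu2⟩
  intro y hy y' hy'
  exact (convex_closedBall y0 ρ).norm_image_sub_le_of_norm_deriv_le
    (fun w hw => (hu w (hsub hw)).1) hder hy' hy

open Filter Topology Metric in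
lemma exist14 (H : ℝ → ℂ → ℂ) (y0 : ℂ)
    (hH : ∀ᶠ p : ℝ × ℂ in 𝓝[≠] (0:ℝ) ×ˢ 𝓝 y0, DifferentiableAt ℂ (H p.1) p.2)
    (hHb : (fun p : ℝ × ℂ => H p.1 p.2) =O[𝓝[≠] (0:ℝ) ×ˢ 𝓝 y0] fun p => p.1 ^ 2) :
    ∃ z : ℝ → ℂ, Tendsto z (𝓝[≠] (0:ℝ)) (𝓝 y0) ∧ ∀ᶠ u in 𝓝[≠] (0:ℝ), z u + H u (z u) = y0 := by
  obtain ⟨C, hC, ρ, hρ, h⟩ := core14 H y0 hH hHb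
  have h1 : ∀ᶠ u in 𝓝[≠] (0:ℝ), ∃ z, z + H u z = y0 ∧ ‖z - y0‖ ≤ C * u ^ 2 := by
    filter_upwards [h ρ hρ le_rfl] with u hu
    obtain ⟨ha, hb, hc⟩ := hu
    have hmaps : Set.MapsTo (fun y => y0 - H u y) (closedBall y0 ρ) (closedBall y0 ρ) := by
      intro y hy
      rw [mem_closedBall, dist_eq_norm]
      have := (ha y hy).2.1
      simp only [sub_sub_cancel_left, norm_neg]
      linarith
    have hcon : ContractingWith (1/2) (hmaps.restrict (fun y => y0 - H u y) _ _) := by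
      refine ⟨by rw [← NNReal.coe_lt_coe]; norm_num, LipschitzWith.of_dist_le_mul ?_⟩
      rintro ⟨a, ha'⟩ ⟨b, hb'⟩
      have := hb b hb' a ha'
      simp only [Subtype.dist_eq, Set.MapsTo.val_restrict_apply, dist_eq_norm]
      rw [sub_sub_sub_cancel_left, norm_sub_rev a b]
      simpa using this
    obtain ⟨z, hz, hfix, -⟩ := ContractingWith.exists_fixedPoint' (isClosed_closedBall.isComplete)
      hmaps hcon (mem_closedBall_self hρ.le) (edist_ne_top _ _)
    have hfix' : y0 - H u z = z := hfix
    refine ⟨z, by linear_combination -hfix', ?_⟩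
    have : z - y0 = - H u z := by linear_combination -hfix'
    rw [this, norm_neg]
    exact (ha z hz).2.1
  obtain ⟨z, hz⟩ := h1.choice
  refine ⟨z, ?_, hz.mono fun u hu => hu.1⟩
  rw [tendsto_iff_norm_sub_tendsto_zero]
  refine squeeze_zero' (Eventually.of_forall fun _ => norm_nonneg _) (hz.mono fun u hu => hu.2) ?_
  have : Continuous (fun u : ℝ => C * u ^ 2) := by fun_prop
  have := this.tendsto 0
  simp only [ne_eq, OfNat.ofNat_ne_zero, not_false_eq_true, zero_pow, mul_zero] at this
  exact this.mono_left nhdsWithin_le_nhds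

open Filter Topology Metric in
lemma fam14 (G H : ℝ → ℂ → ℂ) (y0 : ℂ)
    (hG : ∀ᶠ p : ℝ × ℂ in 𝓝[≠] (0:ℝ) ×ˢ 𝓝 y0, DifferentiableAt ℂ (G p.1) p.2)
    (hGb : (fun p : ℝ × ℂ => G p.1 p.2) =O[𝓝[≠] (0:ℝ) ×ˢ 𝓝 y0] fun _ => (1 : ℝ))
    (hH : ∀ᶠ p : ℝ × ℂ in 𝓝[≠] (0:ℝ) ×ˢ 𝓝 y0, DifferentiableAt ℂ (H p.1) p.2)
    (hHb : (fun p : ℝ × ℂ => H p.1 p.2) =O[𝓝[≠] (0:ℝ) ×ˢ 𝓝 y0] fun p => p.1 ^ 2)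
    (z : ℝ → ℂ) (hz : Tendsto z (𝓝[≠] (0:ℝ)) (𝓝 y0))
    (hz0 : ∀ᶠ u in 𝓝[≠] (0:ℝ), z u + H u (z u) = y0) (N : ℕ) :
    (∀ᶠ u in 𝓝[≠] (0:ℝ), 1 + deriv (H u) (z u) ≠ 0) ∧
    (fun u : ℝ => ∑ j ∈ Finset.range (N + 1), (-1 : ℂ) ^ j *
        iteratedDeriv j (fun y => G u y * H u y ^ j / (Nat.factorial j)) y0 -
        G u (z u) / (1 + deriv (H u) (z u))) =O[𝓝[≠] (0:ℝ)] fun u => u ^ (2 * N + 2) := by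
  obtain ⟨C, hC, ρ₀, hρ₀, h⟩ := core14 H y0 hH hHb
  obtain ⟨M, hM, hGM⟩ := hGb.exists_pos
  obtain ⟨r, hr, hGr⟩ := extr14 (hG.and hGM.bound)
  set ρ := min r ρ₀ with hρdef
  have hρ : 0 < ρ := lt_min hr hρ₀
  have hu := h ρ hρ (min_le_right _ _)
  have hzb := hz.eventually (isOpen_ball.mem_nhds (mem_ball_self hρ))
  have hne : ∀ᶠ u in 𝓝[≠] (0:ℝ), 1 + deriv (H u) (z u) ≠ 0 := by
    filter_upwards [hu, hzb] with u hu hzb h0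
    have h1 := (hu.1 _ (ball_subset_closedBall hzb)).2.2
    have : deriv (H u) (z u) = -1 := by linear_combination h0
    rw [this] at h1
    norm_num at h1
  refine ⟨hne, ?_⟩
  refine IsBigO.of_bound (ρ * (M * (C / ρ) ^ (N + 1) * (2 / ρ))) ?_
  filter_upwards [hu, hzb, hne, hGr, hz0] with u hu hzb hne hGr hz0
  obtain ⟨ha, hb, hc⟩ := hu
  have hGd : DifferentiableOn ℂ (G u) (closedBall y0 ρ) := fun y hy =>
    (hGr y (closedBall_subset_closedBall (min_le_left _ _) hy)).1.differentiableWithinAt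
  have hHd : DifferentiableOn ℂ (H u) (closedBall y0 ρ) := fun y hy =>
    (ha y hy).1.differentiableWithinAt
  have hzc := ball_subset_closedBall hzb
  have key := Lag014 (G u) (H u) y0 ρ M (C * u ^ 2) hρ hGd hHd
    (fun y hy => by
      have := (hGr y (closedBall_subset_closedBall (min_le_left _ _)
        (sphere_subset_closedBall hy))).2
      simpa using this)
    (fun y hy => (ha y (sphere_subset_closedBall hy)).2.1) hc N
  have hderh : HasDerivAt (fun y => y - y0 + H u y) (1 + deriv (H u) (z u)) (z u) :=
    ((hasDerivAt_id (z u)).sub_const y0).add (ha _ hzc).1.hasDerivAt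
  have res := Res014 (G u) (fun y => y - y0 + H u y) y0 (z u) ρ hGd
    ((differentiableOn_id.sub_const y0).add hHd) hzb (by linear_combination hz0)
    (by rw [hderh.deriv]; exact hne)
    (by
      intro y hy h0
      have h1 := hb y hy _ hzc
      have h2 : H u y - H u (z u) = -(y - z u) := by linear_combination h0 - hz0
      rw [h2, norm_neg] at h1
      have : ‖y - z u‖ = 0 := le_antisymm (by linarith) (norm_nonneg _)
      exact sub_eq_zero.1 (norm_eq_zero.1 this))
  rw [res, hderh.deriv] at key
  refine key.trans (le_of_eq ?_)
  rw [norm_pow, Real.norm_eq_abs, show 2 * N + 2 = 2 * (N + 1) by ring, pow_mul, sq_abs,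
    mul_div_right_comm, mul_pow]
  ring


noncomputable def psi14 (Φ : ℂ → ℂ) (u : ℝ) (X : ℂ) : ℂ :=
  (Φ (((Real.exp (u / 2) : ℝ) : ℂ) * X) - Φ (((Real.exp (-u / 2) : ℝ) : ℂ) * X)) /
    ((((Real.exp (u / 2) : ℝ) : ℂ) - ((Real.exp (-u / 2) : ℝ) : ℂ)) * X)

open Filter Topology in
lemma small14 : ∀ᶠ u : ℝ in 𝓝[≠] (0:ℝ), |u / 2| ≤ 1 ∧ u ≠ 0 := by
  have h1 : ∀ᶠ u : ℝ in 𝓝[≠] (0:ℝ), u ≠ 0 := eventually_mem_nhdsWithin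
  have h2 : ∀ᶠ u : ℝ in 𝓝 (0:ℝ), |u / 2| < 1 := by
    have : Continuous fun u : ℝ => |u / 2| := by fun_prop
    exact this.tendsto 0 |>.eventually (gt_mem_nhds (by norm_num))
  filter_upwards [h1, h2.filter_mono nhdsWithin_le_nhds] with u a b using ⟨b.le, a⟩

open Filter Topology in
lemma k114 : (fun u : ℝ => Real.exp (u / 2) + Real.exp (-u / 2) - 2) =O[𝓝[≠] (0:ℝ)] fun u => u ^ 2 := by
  refine IsBigO.of_bound 1 ?_
  filter_upwards [small14] with u hu
  have e1 := Real.exp_bound hu.1 (n := 2) (by norm_num)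
  have e2 := Real.exp_bound (x := -u/2) (by rw [neg_div, abs_neg]; exact hu.1) (n := 2) (by norm_num)
  simp [Finset.sum_range_succ, Nat.factorial] at e1 e2
  rw [Real.norm_eq_abs, Real.norm_eq_abs, abs_of_nonneg (sq_nonneg u)]
  rw [abs_le] at *
  constructor <;> nlinarith [sq_nonneg u]

open Filter Topology in
lemma k214 : (fun u : ℝ => S14 u - 1) =O[𝓝[≠] (0:ℝ)] fun u => u ^ 2 := by
  refine IsBigO.of_bound 1 ?_
  filter_upwards [small14] with u hu
  have e1 := Real.exp_bound hu.1 (n := 3) (by norm_num)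
  have e2 := Real.exp_bound (x := -u/2) (by rw [neg_div, abs_neg]; exact hu.1) (n := 3) (by norm_num)
  simp [Finset.sum_range_succ, Nat.factorial] at e1 e2
  have hu0 := hu.2
  have : S14 u - 1 = (Real.exp (u / 2) - Real.exp (-u / 2) - u) / u := by
    unfold S14; field_simp
  rw [this, norm_div, div_le_iff₀ (norm_pos_iff.2 hu0), Real.norm_eq_abs, Real.norm_eq_abs, Real.norm_eq_abs,
    abs_of_nonneg (sq_nonneg u)]
  have h3 : u ^ 2 * |u| = |u| ^ 3 := by rw [← sq_abs]; ring
  have h4 : |u| ^ 3 ≥ 0 := by positivity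
  rw [one_mul, h3]
  have h5 : |u / 2| ^ 3 = |u| ^ 3 / 8 := by rw [abs_div, abs_two]; ring
  rw [neg_div, abs_neg (u / 2), h5] at e2
  rw [h5] at e1
  rw [neg_div]
  rw [abs_le] at e1 e2 ⊢
  constructor <;> nlinarith

open Filter Topology in
lemma k314 : (fun u : ℝ => (Real.cosh (u / 2))⁻¹ - 1) =O[𝓝[≠] (0:ℝ)] fun u => u ^ 2 := by
  refine IsBigO.trans (IsBigO.of_bound 1 (Eventually.of_forall fun u => ?_)) k114
  have h1 := Real.one_le_cosh (u / 2)
  have h2 : Real.exp (u / 2) + Real.exp (-u / 2) - 2 = 2 * (Real.cosh (u / 2) - 1) := by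
    rw [Real.cosh_eq, neg_div]; ring
  have h3 : (Real.cosh (u / 2))⁻¹ - 1 = -((Real.cosh (u / 2) - 1) / Real.cosh (u / 2)) := by
    field_simp; ring
  rw [h2, h3, norm_neg, norm_div, norm_mul, Real.norm_of_nonneg (by linarith : 0 ≤ Real.cosh (u/2) - 1),
    Real.norm_of_nonneg (by linarith : 0 ≤ Real.cosh (u/2)), div_le_iff₀ (by linarith)]
  norm_num
  nlinarith

open Filter Topology in
lemma sq14 : Tendsto (fun u : ℝ => u ^ 2) (𝓝[≠] (0:ℝ)) (𝓝 0) := by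
  have : Continuous (fun u : ℝ => u ^ 2) := by fun_prop
  have := this.tendsto 0
  simp only [ne_eq, OfNat.ofNat_ne_zero, not_false_eq_true, zero_pow] at this
  exact this.mono_left nhdsWithin_le_nhds

open Filter Topology in
lemma tS14 : Tendsto S14 (𝓝[≠] (0:ℝ)) (𝓝 1) := by
  have := (k214.trans_tendsto sq14).add_const 1
  simpa using this

open Filter Topology in
lemma tE14 : Tendsto (fun u : ℝ => ((Real.exp (u / 2) : ℝ) : ℂ)) (𝓝[≠] (0:ℝ)) (𝓝 1) := by
  have : Continuous (fun u : ℝ => ((Real.exp (u / 2) : ℝ) : ℂ)) := by fun_prop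
  have := this.tendsto 0
  simp only [zero_div, Real.exp_zero, Complex.ofReal_one] at this
  exact this.mono_left nhdsWithin_le_nhds

open Filter Topology in
lemma tE14' : Tendsto (fun u : ℝ => ((Real.exp (-u / 2) : ℝ) : ℂ)) (𝓝[≠] (0:ℝ)) (𝓝 1) := by
  have : Continuous (fun u : ℝ => ((Real.exp (-u / 2) : ℝ) : ℂ)) := by fun_prop
  have := this.tendsto 0
  simp only [neg_zero, zero_div, Real.exp_zero, Complex.ofReal_one] at this
  exact this.mono_left nhdsWithin_le_nhds

lemma expne14 (u : ℝ) (hu : u ≠ 0) : Real.exp (u / 2) - Real.exp (-u / 2) ≠ 0 := by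
  intro h
  have := Real.exp_injective (sub_eq_zero.1 h)
  apply hu; linarith

open Filter Topology in
lemma tmul14 (e : ℝ → ℂ) (he : Tendsto e (𝓝[≠] (0:ℝ)) (𝓝 1)) (a : ℂ) :
    Tendsto (fun p : ℝ × ℂ => e p.1 * p.2) (𝓝[≠] (0:ℝ) ×ˢ 𝓝 a) (𝓝 a) := by
  have := (he.comp (tendsto_fst (g := 𝓝 a))).mul (tendsto_snd (f := 𝓝[≠] (0:ℝ)))
  simpa using this

open Filter Topology in
lemma psid14 (Φ : ℂ → ℂ) (x0 : ℂ) (hx0 : x0 ≠ 0) (hΦ : AnalyticAt ℂ Φ x0) :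
    ∀ᶠ p : ℝ × ℂ in 𝓝[≠] (0:ℝ) ×ˢ 𝓝 x0, DifferentiableAt ℂ (psi14 Φ p.1) p.2 := by
  have h1 := (tmul14 _ tE14 x0).eventually hΦ.eventually_analyticAt
  have h2 := (tmul14 _ tE14' x0).eventually hΦ.eventually_analyticAt
  have h3 : ∀ᶠ p : ℝ × ℂ in 𝓝[≠] (0:ℝ) ×ˢ 𝓝 x0, p.1 ≠ 0 :=
    tendsto_fst.eventually (small14.mono fun u h => h.2)
  have h4 : ∀ᶠ p : ℝ × ℂ in 𝓝[≠] (0:ℝ) ×ˢ 𝓝 x0, p.2 ≠ 0 :=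
    tendsto_snd.eventually (isOpen_ne.mem_nhds hx0)
  filter_upwards [h1, h2, h3, h4] with p h1 h2 h3 h4
  unfold psi14
  refine DifferentiableAt.div (DifferentiableAt.sub ?_ ?_) (by fun_prop) ?_
  · exact DifferentiableAt.fun_comp' (g := Φ) _ h1.differentiableAt (by fun_prop)
  · exact DifferentiableAt.fun_comp' (g := Φ) _ h2.differentiableAt (by fun_prop)
  · refine mul_ne_zero ?_ h4
    have := expne14 p.1 h3
    exact_mod_cast this

open Filter Topology Metric in
lemma psiO14 (Φ : ℂ → ℂ) (x0 : ℂ) (hx0 : x0 ≠ 0) (hΦ : AnalyticAt ℂ Φ x0) :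
    (fun p : ℝ × ℂ => psi14 Φ p.1 p.2 - deriv Φ p.2) =O[𝓝[≠] (0:ℝ) ×ˢ 𝓝 x0] fun p => p.1 ^ 2 := by
  obtain ⟨U, hUn, hU⟩ := hΦ.eventually_analyticAt.exists_mem
  obtain ⟨R, hR, hRU⟩ := Metric.mem_nhds_iff.1 hUn
  set r := R / 2 with hr
  have hr0 : 0 < r := by positivity
  have hd : DifferentiableOn ℂ Φ (ball x0 R) := fun y hy =>
    (hU y (hRU hy)).differentiableAt.differentiableWithinAt
  have hsub : closedBall x0 r ⊆ ball x0 R := closedBall_subset_ball (by linarith)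
  obtain ⟨M, hM⟩ := (isCompact_sphere x0 r).exists_bound_of_continuousOn
    (hd.continuousOn.mono (sphere_subset_closedBall.trans hsub))
  have hb : ball x0 (r / 2) ∈ 𝓝 x0 := ball_mem_nhds _ (by positivity)
  have h1 := (tmul14 _ tE14 x0).eventually hb
  have h2 := (tmul14 _ tE14' x0).eventually hb
  have h3 : ∀ᶠ p : ℝ × ℂ in 𝓝[≠] (0:ℝ) ×ˢ 𝓝 x0, p.1 ≠ 0 :=
    tendsto_fst.eventually (small14.mono fun u h => h.2)
  have h4 : ∀ᶠ p : ℝ × ℂ in 𝓝[≠] (0:ℝ) ×ˢ 𝓝 x0, p.2 ≠ 0 :=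
    tendsto_snd.eventually (isOpen_ne.mem_nhds hx0)
  have h5 : ∀ᶠ p : ℝ × ℂ in 𝓝[≠] (0:ℝ) ×ˢ 𝓝 x0, p.2 ∈ ball x0 (r / 2) :=
    tendsto_snd.eventually hb
  have hk := k114.comp_tendsto (tendsto_fst (f := 𝓝[≠] (0:ℝ)) (g := 𝓝 x0))
  refine IsBigO.trans (IsBigO.of_bound (r * (M * ((‖x0‖ + r) * (‖x0‖ + r) * (2 / r) ^ 4))) ?_) hk
  filter_upwards [h1, h2, h3, h4, h5] with p h1 h2 h3 h4 h5
  obtain ⟨u, X⟩ := p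
  simp only at h1 h2 h3 h4 h5
  have hEE : ((Real.exp (u / 2) : ℝ) : ℂ) * ((Real.exp (-u / 2) : ℝ) : ℂ) = 1 := by
    rw [← Complex.ofReal_mul, ← Real.exp_add]; simp [neg_div]
  have hne : ((Real.exp (u / 2) : ℝ) : ℂ) - ((Real.exp (-u / 2) : ℝ) : ℂ) ≠ 0 := by
    exact_mod_cast expne14 u h3
  simp only [Function.comp]
  rw [← Complex.norm_real (Real.exp (u / 2) + Real.exp (-u / 2) - 2)]
  unfold psi14
  set a : ℂ := ((Real.exp (u / 2) : ℝ) : ℂ) with hadef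
  set b : ℂ := ((Real.exp (-u / 2) : ℝ) : ℂ) with hbdef
  have key := P014 Φ (ball x0 R) isOpen_ball x0 r M hr0 hsub hd hM X (a * X) (b * X) h5 h1 h2
    (by linear_combination X ^ 2 * hEE)
  have hden : (a - b) * X ≠ 0 := mul_ne_zero hne h4
  have e1 : (Φ (a * X) - Φ (b * X)) / ((a - b) * X) - deriv Φ X =
      (Φ (a * X) - Φ (b * X) - (a * X - b * X) * deriv Φ X) / ((a - b) * X) := by
    field_simp
  rw [e1, norm_div, div_le_iff₀ (norm_pos_iff.2 hden)]
  refine key.trans ?_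
  have e2 : a * X - b * X = (a - b) * X := by ring
  have e3 : a * X + b * X - 2 * X = (a + b - 2) * X := by ring
  have hXn : ‖X‖ ≤ ‖x0‖ + r := by
    rw [mem_ball, dist_eq_norm] at h5
    have := norm_le_norm_add_norm_sub x0 X
    rw [norm_sub_rev] at this
    linarith
  have hM0 : 0 ≤ M := by
    have : x0 + r ∈ sphere x0 r := by simp [hr0.le]
    exact (norm_nonneg _).trans (hM _ this)
  rw [e2, e3, norm_mul (a + b - 2)]
  have e4 : (((Real.exp (u / 2) + Real.exp (-u / 2) - 2 : ℝ)) : ℂ) = a + b - 2 := by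
    rw [hadef, hbdef]; push_cast; ring
  rw [e4]
  calc r * (M * (‖(a - b) * X‖ * (‖a + b - 2‖ * ‖X‖) * (‖x0‖ + r) * (2 / r) ^ 4)) 
      ≤ r * (M * (‖(a - b) * X‖ * (‖a + b - 2‖ * (‖x0‖ + r)) * (‖x0‖ + r) * (2 / r) ^ 4)) := by
        gcongr
    _ = _ := by ring

open Filter Topology Metric in
lemma tX14 (xC : ℂ → ℂ) (y0 : ℂ) (hx : AnalyticAt ℂ xC y0) (Xf : ℝ → ℂ → ℂ)
    (hX2 : (fun p : ℝ × ℂ => Xf p.1 p.2 - xC p.2) =O[𝓝[≠] (0:ℝ) ×ˢ 𝓝 y0] fun p => p.1 ^ 2) :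
    Tendsto (fun p : ℝ × ℂ => Xf p.1 p.2) (𝓝[≠] (0:ℝ) ×ˢ 𝓝 y0) (𝓝 (xC y0)) := by
  have h1 := hX2.trans_tendsto (sq14.comp tendsto_fst)
  have h2 : Tendsto (fun p : ℝ × ℂ => xC p.2) (𝓝[≠] (0:ℝ) ×ˢ 𝓝 y0) (𝓝 (xC y0)) :=
    hx.continuousAt.tendsto.comp tendsto_snd
  simpa using h1.add h2

open Filter Topology Metric in
lemma Hd14 (Φ xC : ℂ → ℂ) (y0 : ℂ) (hx : AnalyticAt ℂ xC y0) (hx0 : xC y0 ≠ 0)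
    (hΦ : AnalyticAt ℂ Φ (xC y0)) (Xf : ℝ → ℂ → ℂ)
    (hX1 : ∀ᶠ p : ℝ × ℂ in 𝓝[≠] (0:ℝ) ×ˢ 𝓝 y0, DifferentiableAt ℂ (Xf p.1) p.2)
    (hX2 : (fun p : ℝ × ℂ => Xf p.1 p.2 - xC p.2) =O[𝓝[≠] (0:ℝ) ×ˢ 𝓝 y0] fun p => p.1 ^ 2) :
    ∀ᶠ p : ℝ × ℂ in 𝓝[≠] (0:ℝ) ×ˢ 𝓝 y0,
      DifferentiableAt ℂ (fun y => psi14 Φ p.1 (Xf p.1 y) - y) p.2 := by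
  have ht := (tendsto_fst (f := 𝓝[≠] (0:ℝ)) (g := 𝓝 y0)).prodMk (tX14 xC y0 hx Xf hX2)
  filter_upwards [hX1, ht.eventually (psid14 Φ _ hx0 hΦ)] with p h1 h2
  exact (DifferentiableAt.fun_comp' (g := psi14 Φ p.1) _ h2 h1).sub differentiableAt_id

open Filter Topology Metric in
lemma HO14 (Φ xC : ℂ → ℂ) (y0 : ℂ) (hx : AnalyticAt ℂ xC y0) (hx0 : xC y0 ≠ 0)
    (hΦ : AnalyticAt ℂ Φ (xC y0)) (hinv : ∀ᶠ y in 𝓝 y0, deriv Φ (xC y) = y) (Xf : ℝ → ℂ → ℂ)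
    (hX2 : (fun p : ℝ × ℂ => Xf p.1 p.2 - xC p.2) =O[𝓝[≠] (0:ℝ) ×ˢ 𝓝 y0] fun p => p.1 ^ 2) :
    (fun p : ℝ × ℂ => psi14 Φ p.1 (Xf p.1 p.2) - p.2) =O[𝓝[≠] (0:ℝ) ×ˢ 𝓝 y0] fun p => p.1 ^ 2 := by
  have tX := tX14 xC y0 hx Xf hX2
  have ht := (tendsto_fst (f := 𝓝[≠] (0:ℝ)) (g := 𝓝 y0)).prodMk tX
  have h1 := (psiO14 Φ _ hx0 hΦ).comp_tendsto ht
  have hs := hΦ.deriv.hasStrictDerivAt.hasStrictFDerivAt.isBigO_sub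
  have h2 : Tendsto (fun p : ℝ × ℂ => xC p.2) (𝓝[≠] (0:ℝ) ×ˢ 𝓝 y0) (𝓝 (xC y0)) :=
    hx.continuousAt.tendsto.comp tendsto_snd
  have h3 := hs.comp_tendsto (tX.prodMk_nhds h2)
  have h4 := (h1.add (h3.trans hX2))
  refine h4.congr' ?_ (EventuallyEq.refl _ _)
  filter_upwards [tendsto_snd.eventually hinv] with p hp
  simp [hp]

open Filter Topology Metric in
lemma famX14 (Φ xC f : ℂ → ℂ) (y0 : ℂ) (hx : AnalyticAt ℂ xC y0) (hx0 : xC y0 ≠ 0)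
    (hΦ : AnalyticAt ℂ Φ (xC y0)) (hf : AnalyticAt ℂ f (xC y0))
    (hinv : ∀ᶠ y in 𝓝 y0, deriv Φ (xC y) = y) (Xf D : ℝ → ℂ → ℂ) (s : ℝ → ℂ)
    (hX2 : (fun p : ℝ × ℂ => Xf p.1 p.2 - xC p.2) =O[𝓝[≠] (0:ℝ) ×ˢ 𝓝 y0] fun p => p.1 ^ 2)
    (hXd : ∀ᶠ p : ℝ × ℂ in 𝓝[≠] (0:ℝ) ×ˢ 𝓝 y0, HasDerivAt (Xf p.1) (s p.1 * D p.1 p.2) p.2)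
    (hs : Tendsto s (𝓝[≠] (0:ℝ)) (𝓝 1))
    (hDd : ∀ᶠ p : ℝ × ℂ in 𝓝[≠] (0:ℝ) ×ˢ 𝓝 y0, DifferentiableAt ℂ (D p.1) p.2)
    (hDt : Tendsto (fun p : ℝ × ℂ => D p.1 p.2) (𝓝[≠] (0:ℝ) ×ˢ 𝓝 y0) (𝓝 (deriv xC y0)))
    (z : ℝ → ℂ) (hz : Tendsto z (𝓝[≠] (0:ℝ)) (𝓝 y0))
    (hz0 : ∀ᶠ u in 𝓝[≠] (0:ℝ), psi14 Φ u (Xf u (z u)) = y0) (N : ℕ) :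
    (∀ᶠ p : ℝ × ℂ in 𝓝[≠] (0:ℝ) ×ˢ 𝓝 y0, DifferentiableAt ℂ (fun y => D p.1 y * f (Xf p.1 y)) p.2) ∧
    (fun u : ℝ => s u * ∑ j ∈ Finset.range (N + 1), (-1 : ℂ) ^ j *
        iteratedDeriv j (fun y => (D u y * f (Xf u y)) * (psi14 Φ u (Xf u y) - y) ^ j / (Nat.factorial j)) y0 -
        f (Xf u (z u)) / (deriv (psi14 Φ u) (Xf u (z u)))) =O[𝓝[≠] (0:ℝ)] fun u => u ^ (2 * N + 2) := by
  have hX1 : ∀ᶠ p : ℝ × ℂ in 𝓝[≠] (0:ℝ) ×ˢ 𝓝 y0, DifferentiableAt ℂ (Xf p.1) p.2 :=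
    hXd.mono fun p h => h.differentiableAt
  have tX := tX14 xC y0 hx Xf hX2
  have ht := (tendsto_fst (f := 𝓝[≠] (0:ℝ)) (g := 𝓝 y0)).prodMk tX
  have hGd : ∀ᶠ p : ℝ × ℂ in 𝓝[≠] (0:ℝ) ×ˢ 𝓝 y0,
      DifferentiableAt ℂ (fun y => D p.1 y * f (Xf p.1 y)) p.2 := by
    filter_upwards [hX1, hDd, tX.eventually hf.eventually_analyticAt] with p h1 h2 h3
    exact h2.mul (DifferentiableAt.fun_comp' (g := f) _ h3.differentiableAt h1)
  refine ⟨hGd, ?_⟩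
  have hGb : (fun p : ℝ × ℂ => D p.1 p.2 * f (Xf p.1 p.2)) =O[𝓝[≠] (0:ℝ) ×ˢ 𝓝 y0] fun _ => (1 : ℝ) :=
    (hDt.mul (hf.continuousAt.tendsto.comp tX)).isBigO_one ℝ
  have main := fam14 (fun u y => D u y * f (Xf u y)) (fun u y => psi14 Φ u (Xf u y) - y) y0 hGd hGb
    (Hd14 Φ xC y0 hx hx0 hΦ Xf hX1 hX2) (HO14 Φ xC y0 hx hx0 hΦ hinv Xf hX2) z hz
    (hz0.mono fun u hu => by rw [hu]; ring) N
  obtain ⟨hne, hO⟩ := main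
  have h1 := (hs.isBigO_one ℝ).mul hO
  simp only [one_mul] at h1
  refine h1.congr' ?_ (EventuallyEq.refl _ _)
  have hzz : Tendsto (fun u => (u, z u)) (𝓝[≠] (0:ℝ)) (𝓝[≠] (0:ℝ) ×ˢ 𝓝 y0) := tendsto_id.prodMk hz
  filter_upwards [hne, hzz.eventually hXd, hzz.eventually (ht.eventually (psid14 Φ _ hx0 hΦ))]
    with u hne hXd hpd
  have hd : HasDerivAt (fun y => psi14 Φ u (Xf u y) - y)
      (deriv (psi14 Φ u) (Xf u (z u)) * (s u * D u (z u)) - 1) (z u) :=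
    (HasDerivAt.comp (z u) hpd.hasDerivAt hXd).sub (hasDerivAt_id _)
  rw [hd.deriv, add_sub_cancel] at hne
  rw [hd.deriv, add_sub_cancel, mul_sub]
  congr 1
  have n1 := left_ne_zero_of_mul hne
  have n2 := left_ne_zero_of_mul (right_ne_zero_of_mul hne)
  have n3 := right_ne_zero_of_mul (right_ne_zero_of_mul hne)
  field_simp

open Filter Topology Metric in
lemma trans14 (G H : ℝ → ℂ → ℂ) (Gr Hr : ℝ → ℝ → ℝ) (y0 : ℝ)
    (hG : ∀ᶠ p : ℝ × ℂ in 𝓝[≠] (0:ℝ) ×ˢ 𝓝 (y0 : ℂ), DifferentiableAt ℂ (G p.1) p.2)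
    (hH : ∀ᶠ p : ℝ × ℂ in 𝓝[≠] (0:ℝ) ×ˢ 𝓝 (y0 : ℂ), DifferentiableAt ℂ (H p.1) p.2)
    (eG : ∀ᶠ p : ℝ × ℝ in 𝓝[≠] (0:ℝ) ×ˢ 𝓝 y0, G p.1 p.2 = Gr p.1 p.2)
    (eH : ∀ᶠ p : ℝ × ℝ in 𝓝[≠] (0:ℝ) ×ˢ 𝓝 y0, H p.1 p.2 = Hr p.1 p.2) (N : ℕ) :
    ∀ᶠ u in 𝓝[≠] (0:ℝ), ∑ j ∈ Finset.range (N + 1), (-1 : ℂ) ^ j *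
        iteratedDeriv j (fun y => G u y * H u y ^ j / (Nat.factorial j)) y0 =
      ((∑ j ∈ Finset.range (N + 1), (-1 : ℝ) ^ j *
        iteratedDeriv j (fun y => Gr u y * Hr u y ^ j / (Nat.factorial j)) y0 : ℝ) : ℂ) := by
  filter_upwards [hG.curry, hH.curry, eG.curry, eH.curry] with u hG hH eG eH
  push_cast
  refine Finset.sum_congr rfl fun j _ => ?_
  rw [iterT14 (fun y => G u y * H u y ^ j / (Nat.factorial j))
    (fun y => Gr u y * Hr u y ^ j / (Nat.factorial j)) y0]
  · rw [Complex.analyticAt_iff_eventually_differentiableAt]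
    filter_upwards [hG, hH] with y h1 h2
    exact (h1.mul (h2.pow j)).div_const _
  · filter_upwards [eG, eH] with t h1 h2
    rw [h1, h2]
    push_cast
    rfl

open Filter Topology Metric in
lemma main14 (x Φ f : ℝ → ℝ) (hx : AnalyticOnNhd ℝ x Set.univ)
    (hΦ : AnalyticOnNhd ℝ Φ Set.univ) (hf : AnalyticOnNhd ℝ f Set.univ)
    (hprim : ∀ y : ℝ, deriv Φ (x y) = y) (y₀ : ℝ) (hy₀ : x y₀ ≠ 0) (N : ℕ) :
    (fun u : ℝ =>
        Real.cosh (u / 2) * S14 u *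
            ∑ j ∈ Finset.range (N + 1), (-1 : ℝ) ^ j *
              iteratedDeriv j
                (fun y : ℝ =>
                  deriv x (S14 u * y) * f (x (S14 u * y)) *
                    (A14 x Φ u y) ^ j / (Nat.factorial j)) y₀ -
          ∑ j ∈ Finset.range (N + 1), (-1 : ℝ) ^ j *
            iteratedDeriv j
              (fun y : ℝ =>
                deriv x y * f (x y / Real.cosh (u / 2)) *
                  (B14 x Φ u y) ^ j / (Nat.factorial j)) y₀)
      =O[𝓝[≠] 0] (fun u : ℝ => u ^ (2 * N + 2)) := by
  obtain ⟨xC, hxC, exC⟩ := ext14 x y₀ (hx y₀ trivial)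
  obtain ⟨ΦC, hΦC, eΦC⟩ := ext14 Φ (x y₀) (hΦ _ trivial)
  obtain ⟨fC, hfC, efC⟩ := ext14 f (x y₀) (hf _ trivial)
  have ex0 : xC y₀ = (x y₀ : ℝ) := exC.self_of_nhds
  rw [← ex0] at hΦC hfC
  have hx0 : xC y₀ ≠ 0 := by rw [ex0]; exact_mod_cast hy₀
  have hxr : ContinuousAt x y₀ := (hx y₀ trivial).continuousAt
  -- derivatives on the reals
  have exC' := derivT14 xC x y₀ hxC exC
  have eΦC' := derivT14 ΦC Φ (x y₀) (by rw [← ex0]; exact hΦC) eΦC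
  -- complex inverse relation
  have hinv : ∀ᶠ y in 𝓝 (y₀ : ℂ), deriv ΦC (xC y) = y := by
    have ha : AnalyticAt ℂ (fun y => deriv ΦC (xC y)) (y₀ : ℂ) :=
      AnalyticAt.fun_comp (g := deriv ΦC) hΦC.deriv hxC
    have hfr : ∃ᶠ y in 𝓝[≠] (y₀ : ℂ), deriv ΦC (xC y) = y := by
      have hr : ∀ᶠ t : ℝ in 𝓝[≠] y₀, deriv ΦC (xC t) = (t : ℂ) := by
        refine Eventually.filter_mono nhdsWithin_le_nhds ?_
        filter_upwards [exC, hxr.eventually eΦC'] with t h1 h2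
        rw [h1, h2, hprim]
      have htt : Tendsto (fun t : ℝ => (t : ℂ)) (𝓝[≠] y₀) (𝓝[≠] (y₀ : ℂ)) := by
        refine tendsto_nhdsWithin_iff.2 ⟨(Complex.continuous_ofReal.tendsto y₀).mono_left
          nhdsWithin_le_nhds, ?_⟩
        filter_upwards [eventually_mem_nhdsWithin] with t ht
        simpa using ht
      exact htt.frequently hr.frequently
    exact (ha.frequently_eq_iff_eventually_eq analyticAt_id).1 hfr
  have hdx : deriv xC y₀ ≠ 0 := by
    intro h0
    have h1 : HasDerivAt (fun y => deriv ΦC (xC y)) (deriv (deriv ΦC) (xC y₀) * deriv xC y₀) (y₀ : ℂ) :=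
      HasDerivAt.comp (y₀ : ℂ) hΦC.deriv.differentiableAt.hasDerivAt hxC.differentiableAt.hasDerivAt
    have h2 : HasDerivAt (fun y => deriv ΦC (xC y)) 1 (y₀ : ℂ) :=
      (hasDerivAt_id _).congr_of_eventuallyEq hinv
    have := h1.unique h2
    rw [h0, mul_zero] at this
    exact zero_ne_one this
  have hinv2 : ∀ᶠ X in 𝓝 (xC y₀), xC (deriv ΦC X) = X := by
    rw [← hxC.hasStrictDerivAt.map_nhds_eq hdx, eventually_map]
    filter_upwards [hinv] with y hy
    rw [hy]
  have hθ0 : deriv ΦC (xC y₀) = y₀ := hinv.self_of_nhds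
  -- scalars
  have tS : Tendsto (fun u => ((S14 u : ℝ) : ℂ)) (𝓝[≠] (0:ℝ)) (𝓝 1) := by
    have := (Complex.continuous_ofReal.tendsto 1).comp tS14
    rw [Complex.ofReal_one] at this
    exact this
  have tc' : Tendsto (fun u : ℝ => Real.cosh (u / 2)) (𝓝[≠] (0:ℝ)) (𝓝 1) := by
    have : Continuous (fun u : ℝ => Real.cosh (u / 2)) := by fun_prop
    have := this.tendsto 0
    simp only [zero_div, Real.cosh_zero] at this
    exact this.mono_left nhdsWithin_le_nhds
  have tc : Tendsto (fun u : ℝ => ((Real.cosh (u / 2) : ℝ) : ℂ)) (𝓝[≠] (0:ℝ)) (𝓝 1) := by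
    have := (Complex.continuous_ofReal.tendsto 1).comp tc'
    rw [Complex.ofReal_one] at this
    exact this
  have tci : Tendsto (fun u : ℝ => ((Real.cosh (u / 2) : ℝ) : ℂ)⁻¹) (𝓝[≠] (0:ℝ)) (𝓝 1) := by
    simpa using tc.inv₀ one_ne_zero
  have hcne : ∀ u : ℝ, ((Real.cosh (u / 2) : ℝ) : ℂ) ≠ 0 := fun u => by
    exact_mod_cast (Real.cosh_pos _).ne'
  -- family A
  have tSy := tmul14 _ tS (y₀ : ℂ)
  have XA2 : (fun p : ℝ × ℂ => xC (((S14 p.1 : ℝ) : ℂ) * p.2) - xC p.2)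
      =O[𝓝[≠] (0:ℝ) ×ˢ 𝓝 (y₀ : ℂ)] fun p => p.1 ^ 2 := by
    have h1 := hxC.hasStrictDerivAt.hasStrictFDerivAt.isBigO_sub.comp_tendsto
      (tSy.prodMk_nhds tendsto_snd)
    refine h1.trans ?_
    have h2 : (fun p : ℝ × ℂ => ((S14 p.1 - 1 : ℝ) : ℂ)) =O[𝓝[≠] (0:ℝ) ×ˢ 𝓝 (y₀ : ℂ)] fun p => p.1 ^ 2 :=
      Complex.isBigO_ofReal_left.2 (k214.comp_tendsto tendsto_fst)
    have h3 : (fun p : ℝ × ℂ => p.2) =O[𝓝[≠] (0:ℝ) ×ˢ 𝓝 (y₀ : ℂ)] fun _ => (1 : ℝ) :=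
      (tendsto_snd (f := 𝓝[≠] (0:ℝ)) (g := 𝓝 (y₀ : ℂ))).isBigO_one ℝ
    refine (h2.mul h3).congr (fun p => ?_) (fun p => by simp)
    simp only [Function.comp]
    push_cast
    ring
  have XAd : ∀ᶠ p : ℝ × ℂ in 𝓝[≠] (0:ℝ) ×ˢ 𝓝 (y₀ : ℂ),
      HasDerivAt (fun y => xC (((S14 p.1 : ℝ) : ℂ) * y))
        (((S14 p.1 : ℝ) : ℂ) * deriv xC (((S14 p.1 : ℝ) : ℂ) * p.2)) p.2 := by
    filter_upwards [tSy.eventually hxC.eventually_analyticAt] with p hp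
    have h1 : HasDerivAt (fun y : ℂ => ((S14 p.1 : ℝ) : ℂ) * y) (((S14 p.1 : ℝ) : ℂ) * 1) p.2 :=
      (hasDerivAt_id _).const_mul _
    have h2 := HasDerivAt.comp p.2 hp.differentiableAt.hasDerivAt h1
    rw [mul_one, mul_comm] at h2
    exact h2
  have DAd : ∀ᶠ p : ℝ × ℂ in 𝓝[≠] (0:ℝ) ×ˢ 𝓝 (y₀ : ℂ),
      DifferentiableAt ℂ (fun y => deriv xC (((S14 p.1 : ℝ) : ℂ) * y)) p.2 := by
    filter_upwards [tSy.eventually hxC.eventually_analyticAt] with p hp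
    exact DifferentiableAt.fun_comp' (g := deriv xC) _ hp.deriv.differentiableAt (by fun_prop)
  have DAt : Tendsto (fun p : ℝ × ℂ => deriv xC (((S14 p.1 : ℝ) : ℂ) * p.2))
      (𝓝[≠] (0:ℝ) ×ˢ 𝓝 (y₀ : ℂ)) (𝓝 (deriv xC y₀)) := hxC.deriv.continuousAt.tendsto.comp tSy
  -- family B
  have XB2 : (fun p : ℝ × ℂ => xC p.2 / ((Real.cosh (p.1 / 2) : ℝ) : ℂ) - xC p.2)
      =O[𝓝[≠] (0:ℝ) ×ˢ 𝓝 (y₀ : ℂ)] fun p => p.1 ^ 2 := by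
    have h2 : (fun p : ℝ × ℂ => (((Real.cosh (p.1 / 2))⁻¹ - 1 : ℝ) : ℂ)) =O[𝓝[≠] (0:ℝ) ×ˢ 𝓝 (y₀ : ℂ)] fun p => p.1 ^ 2 :=
      Complex.isBigO_ofReal_left.2 (k314.comp_tendsto tendsto_fst)
    have h3 : (fun p : ℝ × ℂ => xC p.2) =O[𝓝[≠] (0:ℝ) ×ˢ 𝓝 (y₀ : ℂ)] fun _ => (1 : ℝ) :=
      (hxC.continuousAt.tendsto.comp
        (tendsto_snd (f := 𝓝[≠] (0:ℝ)) (g := 𝓝 (y₀ : ℂ)))).isBigO_one ℝ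
    refine (h2.mul h3).congr (fun p => ?_) (fun p => by simp)
    push_cast
    ring
  have hevx : ∀ᶠ p : ℝ × ℂ in 𝓝[≠] (0:ℝ) ×ˢ 𝓝 (y₀ : ℂ), AnalyticAt ℂ xC p.2 :=
    tendsto_snd.eventually hxC.eventually_analyticAt
  have XBd : ∀ᶠ p : ℝ × ℂ in 𝓝[≠] (0:ℝ) ×ˢ 𝓝 (y₀ : ℂ),
      HasDerivAt (fun y => xC y / ((Real.cosh (p.1 / 2) : ℝ) : ℂ))
        (((Real.cosh (p.1 / 2) : ℝ) : ℂ)⁻¹ * deriv xC p.2) p.2 := by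
    filter_upwards [hevx] with p hp
    have := hp.differentiableAt.hasDerivAt.div_const ((Real.cosh (p.1 / 2) : ℝ) : ℂ)
    rwa [div_eq_inv_mul (deriv xC p.2)] at this
  have DBd : ∀ᶠ p : ℝ × ℂ in 𝓝[≠] (0:ℝ) ×ˢ 𝓝 (y₀ : ℂ),
      DifferentiableAt ℂ (fun y => deriv xC y) p.2 := by
    filter_upwards [hevx] with p hp
    exact hp.deriv.differentiableAt
  have DBt : Tendsto (fun p : ℝ × ℂ => deriv xC p.2)
      (𝓝[≠] (0:ℝ) ×ˢ 𝓝 (y₀ : ℂ)) (𝓝 (deriv xC y₀)) := hxC.deriv.continuousAt.tendsto.comp tendsto_snd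
  -- the zeros
  have HBd := Hd14 ΦC xC y₀ hxC hx0 hΦC (fun u y => xC y / ((Real.cosh (u / 2) : ℝ) : ℂ))
    (XBd.mono fun p h => h.differentiableAt) XB2
  have HAd := Hd14 ΦC xC y₀ hxC hx0 hΦC (fun u y => xC (((S14 u : ℝ) : ℂ) * y))
    (XAd.mono fun p h => h.differentiableAt) XA2
  obtain ⟨zB, zBt, zB0⟩ := exist14
    (fun u y => psi14 ΦC u (xC y / ((Real.cosh (u / 2) : ℝ) : ℂ)) - y) y₀ HBd
    (HO14 ΦC xC y₀ hxC hx0 hΦC hinv (fun u y => xC y / ((Real.cosh (u / 2) : ℝ) : ℂ)) XB2)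
  have zB0' : ∀ᶠ u in 𝓝[≠] (0:ℝ), psi14 ΦC u (xC (zB u) / ((Real.cosh (u / 2) : ℝ) : ℂ)) = y₀ :=
    zB0.mono fun u hu => by linear_combination hu
  have tξ : Tendsto (fun u => xC (zB u) / ((Real.cosh (u / 2) : ℝ) : ℂ)) (𝓝[≠] (0:ℝ)) (𝓝 (xC y₀)) := by
    have := (hxC.continuousAt.tendsto.comp zBt).div tc one_ne_zero
    rw [div_one] at this
    exact this
  have hSne : ∀ᶠ u in 𝓝[≠] (0:ℝ), ((S14 u : ℝ) : ℂ) ≠ 0 := tS.eventually_ne one_ne_zero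
  set zA : ℝ → ℂ := fun u => deriv ΦC (xC (zB u) / ((Real.cosh (u / 2) : ℝ) : ℂ)) / ((S14 u : ℝ) : ℂ)
    with hzA
  have zAt : Tendsto zA (𝓝[≠] (0:ℝ)) (𝓝 (y₀ : ℂ)) := by
    have := (hΦC.deriv.continuousAt.tendsto.comp tξ).div tS one_ne_zero
    rw [hθ0, div_one] at this
    exact this
  have hXAB : ∀ᶠ u in 𝓝[≠] (0:ℝ), xC (((S14 u : ℝ) : ℂ) * zA u) =
      xC (zB u) / ((Real.cosh (u / 2) : ℝ) : ℂ) := by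
    filter_upwards [hSne, tξ.eventually hinv2] with u h1 h2
    rw [hzA]
    simp only
    rw [mul_div_cancel₀ _ h1]
    exact h2
  have zA0 : ∀ᶠ u in 𝓝[≠] (0:ℝ), psi14 ΦC u (xC (((S14 u : ℝ) : ℂ) * zA u)) = y₀ := by
    filter_upwards [hXAB, zB0'] with u h1 h2
    rw [h1, h2]
  obtain ⟨GAd, OA⟩ := famX14 ΦC xC fC y₀ hxC hx0 hΦC hfC hinv (fun u y => xC (((S14 u : ℝ) : ℂ) * y))
    (fun u y => deriv xC (((S14 u : ℝ) : ℂ) * y)) (fun u => ((S14 u : ℝ) : ℂ)) XA2 XAd tS DAd DAt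
    zA zAt zA0 N
  obtain ⟨GBd, OB⟩ := famX14 ΦC xC fC y₀ hxC hx0 hΦC hfC hinv
    (fun u y => xC y / ((Real.cosh (u / 2) : ℝ) : ℂ))
    (fun u y => deriv xC y) (fun u => ((Real.cosh (u / 2) : ℝ) : ℂ)⁻¹) XB2 XBd tci DBd DBt
    zB zBt zB0' N
  -- real versions
  have hune : ∀ᶠ p : ℝ × ℝ in 𝓝[≠] (0:ℝ) ×ˢ 𝓝 y₀, p.1 ≠ 0 :=
    tendsto_fst.eventually (small14.mono fun u h => h.2)
  have tSr : Tendsto (fun p : ℝ × ℝ => S14 p.1 * p.2) (𝓝[≠] (0:ℝ) ×ˢ 𝓝 y₀) (𝓝 y₀) := by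
    have := (tS14.comp (tendsto_fst (g := 𝓝 y₀))).mul (tendsto_snd (f := 𝓝[≠] (0:ℝ)))
    simpa using this
  have tXAr : Tendsto (fun p : ℝ × ℝ => x (S14 p.1 * p.2)) (𝓝[≠] (0:ℝ) ×ˢ 𝓝 y₀) (𝓝 (x y₀)) :=
    hxr.tendsto.comp tSr
  have tXBr : Tendsto (fun p : ℝ × ℝ => x p.2 / Real.cosh (p.1 / 2)) (𝓝[≠] (0:ℝ) ×ˢ 𝓝 y₀) (𝓝 (x y₀)) := by
    have := (hxr.tendsto.comp (tendsto_snd (f := 𝓝[≠] (0:ℝ)))).div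
      (tc'.comp (tendsto_fst (g := 𝓝 y₀))) one_ne_zero
    rw [div_one] at this
    exact this
  have psir : ∀ (Xr : ℝ × ℝ → ℝ), Tendsto Xr (𝓝[≠] (0:ℝ) ×ˢ 𝓝 y₀) (𝓝 (x y₀)) →
      ∀ᶠ p : ℝ × ℝ in 𝓝[≠] (0:ℝ) ×ˢ 𝓝 y₀, psi14 ΦC p.1 (Xr p) =
        (((Φ (Real.exp (p.1 / 2) * Xr p) - Φ (Real.exp (-p.1 / 2) * Xr p)) /
          (p.1 * S14 p.1 * Xr p) : ℝ) : ℂ) := by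
    intro Xr hXr
    have e1 : Tendsto (fun p : ℝ × ℝ => Real.exp (p.1 / 2) * Xr p) (𝓝[≠] (0:ℝ) ×ˢ 𝓝 y₀) (𝓝 (x y₀)) := by
      have hc : Tendsto (fun u : ℝ => Real.exp (u / 2)) (𝓝[≠] (0:ℝ)) (𝓝 1) := by
        have : Continuous (fun u : ℝ => Real.exp (u / 2)) := by fun_prop
        have := this.tendsto 0
        simp only [zero_div, Real.exp_zero] at this
        exact this.mono_left nhdsWithin_le_nhds
      have := (hc.comp (tendsto_fst (g := 𝓝 y₀))).mul hXr
      simpa using this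
    have e2 : Tendsto (fun p : ℝ × ℝ => Real.exp (-p.1 / 2) * Xr p) (𝓝[≠] (0:ℝ) ×ˢ 𝓝 y₀) (𝓝 (x y₀)) := by
      have hc : Tendsto (fun u : ℝ => Real.exp (-u / 2)) (𝓝[≠] (0:ℝ)) (𝓝 1) := by
        have : Continuous (fun u : ℝ => Real.exp (-u / 2)) := by fun_prop
        have := this.tendsto 0
        simp only [neg_zero, zero_div, Real.exp_zero] at this
        exact this.mono_left nhdsWithin_le_nhds
      have := (hc.comp (tendsto_fst (g := 𝓝 y₀))).mul hXr
      simpa using this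
    filter_upwards [e1.eventually eΦC, e2.eventually eΦC, hune] with p h1 h2 h3
    have h4 : p.1 * S14 p.1 = Real.exp (p.1 / 2) - Real.exp (-p.1 / 2) := by
      unfold S14; field_simp
    rw [h4]
    unfold psi14
    rw [← Complex.ofReal_mul, ← Complex.ofReal_mul, h1, h2]
    norm_cast
  have eGA : ∀ᶠ p : ℝ × ℝ in 𝓝[≠] (0:ℝ) ×ˢ 𝓝 y₀,
      deriv xC (((S14 p.1 : ℝ) : ℂ) * (p.2 : ℂ)) * fC (xC (((S14 p.1 : ℝ) : ℂ) * (p.2 : ℂ))) =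
        ((deriv x (S14 p.1 * p.2) * f (x (S14 p.1 * p.2)) : ℝ) : ℂ) := by
    filter_upwards [tSr.eventually exC, tSr.eventually exC', tXAr.eventually efC] with p h1 h2 h3
    rw [← Complex.ofReal_mul, h1, h2, h3, Complex.ofReal_mul]
  have eHA : ∀ᶠ p : ℝ × ℝ in 𝓝[≠] (0:ℝ) ×ˢ 𝓝 y₀,
      psi14 ΦC p.1 (xC (((S14 p.1 : ℝ) : ℂ) * (p.2 : ℂ))) - (p.2 : ℂ) = ((A14 x Φ p.1 p.2 : ℝ) : ℂ) := by
    filter_upwards [tSr.eventually exC, psir _ tXAr] with p h1 h2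
    rw [← Complex.ofReal_mul, h1, h2, ← Complex.ofReal_sub]
    rfl
  have eGB : ∀ᶠ p : ℝ × ℝ in 𝓝[≠] (0:ℝ) ×ˢ 𝓝 y₀,
      deriv xC (p.2 : ℂ) * fC (xC (p.2 : ℂ) / ((Real.cosh (p.1 / 2) : ℝ) : ℂ)) =
        ((deriv x p.2 * f (x p.2 / Real.cosh (p.1 / 2)) : ℝ) : ℂ) := by
    filter_upwards [tendsto_snd.eventually exC, tendsto_snd.eventually exC', tXBr.eventually efC]
      with p h1 h2 h3
    rw [h1, h2, ← Complex.ofReal_div, h3, Complex.ofReal_mul]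
  have eHB : ∀ᶠ p : ℝ × ℝ in 𝓝[≠] (0:ℝ) ×ˢ 𝓝 y₀,
      psi14 ΦC p.1 (xC (p.2 : ℂ) / ((Real.cosh (p.1 / 2) : ℝ) : ℂ)) - (p.2 : ℂ) =
        ((B14 x Φ p.1 p.2 : ℝ) : ℂ) := by
    filter_upwards [tendsto_snd.eventually exC, psir _ tXBr] with p h1 h2
    rw [h1, ← Complex.ofReal_div, h2, ← Complex.ofReal_sub]
    unfold B14
    simp only [mul_div_assoc]
  have TA := trans14 (fun u y => deriv xC (((S14 u : ℝ) : ℂ) * y) * fC (xC (((S14 u : ℝ) : ℂ) * y)))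
    (fun u y => psi14 ΦC u (xC (((S14 u : ℝ) : ℂ) * y)) - y)
    (fun u y => deriv x (S14 u * y) * f (x (S14 u * y))) (fun u y => A14 x Φ u y) y₀ GAd HAd eGA eHA N
  have TB := trans14 (fun u y => deriv xC y * fC (xC y / ((Real.cosh (u / 2) : ℝ) : ℂ)))
    (fun u y => psi14 ΦC u (xC y / ((Real.cosh (u / 2) : ℝ) : ℂ)) - y)
    (fun u y => deriv x y * f (x y / Real.cosh (u / 2))) (fun u y => B14 x Φ u y) y₀ GBd HBd eGB eHB N
  have fin := (tc.isBigO_one ℝ).mul (OA.sub OB)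
  rw [← Complex.isBigO_ofReal_left]
  simp only [one_mul] at fin
  refine fin.congr' ?_ (EventuallyEq.refl _ _)
  filter_upwards [TA, TB, hXAB] with u h1 h2 h3
  rw [h1, h2, h3, Complex.ofReal_sub, Complex.ofReal_mul, Complex.ofReal_mul]
  have := hcne u
  field_simp
  ring

/-- Lemma 2.4 of the paper, formulated as: for every truncation order `N`, the
difference of the two truncated sums is `o(u^{2N+1})` as `u → 0` through nonzero
values. -/
theorem stmt_14 (x Φ f : ℝ → ℝ) (hx : AnalyticOnNhd ℝ x Set.univ)
    (hΦ : AnalyticOnNhd ℝ Φ Set.univ) (hf : AnalyticOnNhd ℝ f Set.univ)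
    (hprim : ∀ y : ℝ, deriv Φ (x y) = y) (y₀ : ℝ) (hy₀ : x y₀ ≠ 0) (N : ℕ) :
    (fun u : ℝ =>
        Real.cosh (u / 2) * S14 u *
            ∑ j ∈ Finset.range (N + 1), (-1 : ℝ) ^ j *
              iteratedDeriv j
                (fun y : ℝ =>
                  deriv x (S14 u * y) * f (x (S14 u * y)) *
                    (A14 x Φ u y) ^ j / (Nat.factorial j)) y₀ -
          ∑ j ∈ Finset.range (N + 1), (-1 : ℝ) ^ j *
            iteratedDeriv j
              (fun y : ℝ =>
                deriv x y * f (x y / Real.cosh (u / 2)) *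
                  (B14 x Φ u y) ^ j / (Nat.factorial j)) y₀)
      =o[nhdsWithin 0 {0}ᶜ] (fun u : ℝ => u ^ (2 * N + 1)) := by
  refine (main14 x Φ f hx hΦ hf hprim y₀ hy₀ N).trans_isLittleO ?_
  have h := (Asymptotics.isLittleO_pow_pow (𝕜 := ℝ) (show 2 * N + 1 < 2 * N + 2 by omega))
  exact h.mono nhdsWithin_le_nhds
end
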